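/- Regret bound of the EvE (exploration-versus-exploitation) policy: under the sequential EvE-policy model there exists a universal constant C_EvE > 0 such that for all T ≥ 2 the expected cumulative regret satisfies E[Reg(T)] ≤ C_EvE · log T. -/

import Mathlib

open MeasureTheory ProbabilityTheory Set

noncomputable section

/-- Standard normal density. -/
def stdPdf (z : ℝ) : ℝ := Real.exp (-z ^ 2 / 2) / Real.sqrt (2 * Real.pi)

/-- Standard normal cdf. -/
def stdCdf (c : ℝ) : ℝ := ∫ z in Set.Iio c, stdPdf z

/-- Mean of a standard normal truncated to `(c, ∞)`. -/
def truncMeanAbove (c : ℝ) : ℝ :=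
  (∫ z in Set.Ioi c, z * stdPdf z) / (∫ z in Set.Ioi c, stdPdf z)

/-- Mean of a standard normal truncated to `(-∞, c)`. -/
def truncMeanBelow (c : ℝ) : ℝ :=
  (∫ z in Set.Iio c, z * stdPdf z) / (∫ z in Set.Iio c, stdPdf z)

/-- Mean of a standard normal truncated to `(a, b)`. -/
def truncMeanBetween (a b : ℝ) : ℝ :=
  (∫ z in Set.Ioo a b, z * stdPdf z) / (∫ z in Set.Ioo a b, stdPdf z)

/-- Signum, with the (measure-zero) value at `0` set to `-1`. -/
def sgn (x : ℝ) : ℝ := if 0 < x then 1 else -1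

/-- The standard normal measure on `ℝ`. -/
def stdNormal : Measure ℝ := gaussianReal 0 1

/-- The joint law of two independent standard normals. -/
def stdNormal2 : Measure (ℝ × ℝ) := stdNormal.prod stdNormal

/-- Uniform measure on `[-1, 1]` (the prior on the state θ). -/
def uniformState : Measure ℝ := (2 : ENNReal)⁻¹ • volume.restrict (Set.Icc (-1 : ℝ) 1)

instance : IsProbabilityMeasure stdNormal := by unfold stdNormal; infer_instance
instance : IsProbabilityMeasure stdNormal2 := by unfold stdNormal2; infer_instance
/-- The EvE threshold function `c`. For `y > 0` it is the (unique) solution of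
`φ c / Φ c = y`, realized as an infimum since the inverse Mills ratio
`c ↦ φ c / Φ c` is strictly decreasing from `∞` to `0`; for `y < 0` it is the
(unique) solution of `φ c / (1 - Φ c) = -y`, realized as a supremum since
`c ↦ φ c / (1 - Φ c)` is strictly increasing from `0` to `∞`; and `c 0 := 0`. -/
def cFun (y : ℝ) : ℝ :=
  if 0 < y then sInf {c : ℝ | stdPdf c / stdCdf c ≤ y}
  else if y < 0 then sSup {c : ℝ | stdPdf c / (1 - stdCdf c) ≤ -y}
  else 0

/-- The superior arm. -/
def bStar (θ x z : ℝ) : ℝ := if 0 < x * θ + z then 1 else -1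

/-- User's posterior mean of the dynamic payoff under a binary threshold policy
with threshold `ρ` (message `a = 1` iff `z > ρ`). -/
def ZThr (ρ z : ℝ) : ℝ := if ρ < z then truncMeanAbove ρ else truncMeanBelow ρ

/-- User's action under a binary threshold policy with threshold `ρ`. -/
def bThr (θ ρ x z : ℝ) : ℝ := if 0 < x * θ + ZThr ρ z then 1 else -1

/-- One-step update of the confidence interval under a binary threshold policy. -/
def updThr (θ ρ l u x z : ℝ) : ℝ × ℝ :=
  if bThr θ ρ x z * sgn x < 0 then (l, min u (-(ZThr ρ z / x)))
  else (max l (-(ZThr ρ z / x)), u)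

/-- The EvE threshold in a round with confidence interval `(l, u)` and context `x`,
for horizon `T`: `c(x·m)` in the exploration phase (`w > 1/√T`) and the
straightforward threshold `-x·m` in the exploitation phase. -/
def eveRho (T : ℕ) (l u x : ℝ) : ℝ :=
  if 1 / Real.sqrt T < u - l then cFun (x * ((l + u) / 2)) else -(x * ((l + u) / 2))

/-- Confidence interval `(l_t, u_t)` of the recommender under the EvE policy with
horizon `T`, starting from `(-1, 1)`, when the state is `θ` and `ω t = (x_t, z_t)`. -/
def eveLU (T : ℕ) (θ : ℝ) (ω : ℕ → ℝ × ℝ) : ℕ → ℝ × ℝ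
  | 0 => (-1, 1)
  | t + 1 =>
    updThr θ (eveRho T (eveLU T θ ω t).1 (eveLU T θ ω t).2 (ω t).1)
      (eveLU T θ ω t).1 (eveLU T θ ω t).2 (ω t).1 (ω t).2

/-- Cumulative regret over `T` rounds under the EvE policy. -/
def eveCumReg (T : ℕ) (θ : ℝ) (ω : ℕ → ℝ × ℝ) : ℝ :=
  ∑ t ∈ Finset.range T,
    (if bThr θ (eveRho T (eveLU T θ ω t).1 (eveLU T θ ω t).2 (ω t).1) (ω t).1 (ω t).2 =
        bStar θ (ω t).1 (ω t).2
     then 0 else |(ω t).1 * θ + (ω t).2|)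

lemma stdPdf_eq_gaussianPDFReal : stdPdf = gaussianPDFReal 0 1 := by
  funext z
  simp [stdPdf, gaussianPDFReal, div_eq_inv_mul, mul_comm]

lemma stdPdf_pos (z : ℝ) : 0 < stdPdf z := by
  unfold stdPdf; positivity

lemma continuous_stdPdf : Continuous stdPdf := by
  unfold stdPdf; fun_prop

lemma stdPdf_neg (z : ℝ) : stdPdf (-z) = stdPdf z := by
  simp [stdPdf]

lemma stdPdf_le_one (z : ℝ) : stdPdf z ≤ 1 := by
  unfold stdPdf
  have h1 : Real.exp (-z ^ 2 / 2) ≤ 1 := Real.exp_le_one_iff.2 (by nlinarith [sq_nonneg z])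
  have h2 : 1 ≤ Real.sqrt (2 * Real.pi) :=
    Real.one_le_sqrt.2 (by nlinarith [Real.pi_gt_three])
  exact (div_le_one (by linarith)).2 (h1.trans h2)

lemma integrable_stdPdf : Integrable stdPdf := by
  rw [stdPdf_eq_gaussianPDFReal]; exact integrable_gaussianPDFReal 0 1

lemma integrable_mul_stdPdf : Integrable fun z => z * stdPdf z := by
  have h := (integrable_mul_exp_neg_mul_sq (b := 1 / 2) (by norm_num)).div_const
    (Real.sqrt (2 * Real.pi))
  convert h using 2 with z
  simp only [stdPdf]
  rw [mul_div_assoc]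
  congr 4
  ring

lemma hasDerivAt_stdPdf (z : ℝ) : HasDerivAt stdPdf (-(z * stdPdf z)) z := by
  have h : HasDerivAt (fun z : ℝ => -z ^ 2 / 2) (-z) z :=
    ((hasDerivAt_pow 2 z).neg.div_const 2).congr_deriv (by norm_num; ring)
  exact (h.exp.div_const (Real.sqrt (2 * Real.pi))).congr_deriv (by unfold stdPdf; ring)

lemma tendsto_stdPdf_atTop : Filter.Tendsto stdPdf Filter.atTop (nhds 0) :=
  tendsto_zero_of_hasDerivAt_of_integrableOn_Ioi (a := 0) (fun z _ => hasDerivAt_stdPdf z)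
    integrable_mul_stdPdf.neg.integrableOn integrable_stdPdf.integrableOn

lemma integral_Ioi_mul_stdPdf (c : ℝ) : ∫ z in Set.Ioi c, z * stdPdf z = stdPdf c := by
  have h := integral_Ioi_of_hasDerivAt_of_tendsto' (a := c) (m := 0)
    (fun z _ => hasDerivAt_stdPdf z)
    integrable_mul_stdPdf.neg.integrableOn tendsto_stdPdf_atTop
  rw [integral_neg] at h
  linarith

lemma integral_Ioi_stdPdf (c : ℝ) : ∫ z in Set.Ioi c, stdPdf z = stdCdf (-c) := by
  have h := integral_comp_neg_Ioi c stdPdf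
  simp only [stdPdf_neg] at h
  rw [h, integral_Iic_eq_integral_Iio, stdCdf]

lemma integral_Iio_mul_stdPdf (c : ℝ) : ∫ z in Set.Iio c, z * stdPdf z = -stdPdf c := by
  have h := integral_comp_neg_Ioi (-c) (fun z => z * stdPdf z)
  simp only [stdPdf_neg, neg_neg, neg_mul] at h
  rw [← integral_Iic_eq_integral_Iio, ← h, integral_neg, integral_Ioi_mul_stdPdf, stdPdf_neg]

lemma stdCdf_pos (c : ℝ) : 0 < stdCdf c := by
  unfold stdCdf
  rw [setIntegral_pos_iff_support_of_nonneg_ae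
    (Filter.Eventually.of_forall fun z => (stdPdf_pos z).le) integrable_stdPdf.integrableOn]
  have : Function.support stdPdf = Set.univ := by
    ext z; simp [(stdPdf_pos z).ne']
  simp [this]

lemma stdCdf_mono : Monotone stdCdf := fun _ _ h =>
  setIntegral_mono_set integrable_stdPdf.integrableOn
    (Filter.Eventually.of_forall fun z => (stdPdf_pos z).le)
    (Set.Iio_subset_Iio h).eventuallyLE

lemma one_sub_stdCdf (c : ℝ) : 1 - stdCdf c = stdCdf (-c) := by
  have h := intervalIntegral.integral_Iio_add_Ici (b := c) (f := stdPdf) (μ := volume)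
    integrable_stdPdf.integrableOn integrable_stdPdf.integrableOn
  rw [integral_Ici_eq_integral_Ioi, integral_Ioi_stdPdf] at h
  have h1 : ∫ z, stdPdf z = 1 := by
    rw [stdPdf_eq_gaussianPDFReal]; exact integral_gaussianPDFReal_eq_one 0 one_ne_zero
  rw [h1] at h
  unfold stdCdf at *
  linarith

lemma continuous_stdCdf : Continuous stdCdf := by
  have h : stdCdf = fun c => stdCdf 0 + ∫ z in (0 : ℝ)..c, stdPdf z := by
    funext c
    rw [← intervalIntegral.integral_Iic_sub_Iic integrable_stdPdf.integrableOn
      integrable_stdPdf.integrableOn]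
    simp only [integral_Iic_eq_integral_Iio, stdCdf]
    ring
  rw [h]
  exact continuous_const.add
    (intervalIntegral.continuous_primitive (fun _ _ => integrable_stdPdf.intervalIntegrable) 0)

/-- The ratio `φ / Φ`. -/
def invMills (c : ℝ) : ℝ := stdPdf c / stdCdf c

lemma invMills_pos (c : ℝ) : 0 < invMills c := div_pos (stdPdf_pos c) (stdCdf_pos c)

lemma continuous_invMills : Continuous invMills :=
  continuous_stdPdf.div continuous_stdCdf fun c => (stdCdf_pos c).ne'

lemma truncMeanBelow_eq (c : ℝ) : truncMeanBelow c = -invMills c := by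
  unfold truncMeanBelow invMills
  rw [integral_Iio_mul_stdPdf, neg_div]; rfl

lemma truncMeanAbove_eq (c : ℝ) : truncMeanAbove c = invMills (-c) := by
  unfold truncMeanAbove invMills
  rw [integral_Ioi_mul_stdPdf, integral_Ioi_stdPdf, stdPdf_neg]

lemma neg_mul_stdCdf_le (c : ℝ) : -c * stdCdf c ≤ stdPdf c := by
  have h : 0 ≤ ∫ z in Set.Iio c, (c * stdPdf z - z * stdPdf z) :=
    setIntegral_nonneg measurableSet_Iio fun z hz => by
      have := stdPdf_pos z
      have : z < c := hz
      nlinarith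
  rw [integral_sub (integrable_stdPdf.const_mul c).integrableOn
    integrable_mul_stdPdf.integrableOn, integral_const_mul, integral_Iio_mul_stdPdf] at h
  unfold stdCdf
  linarith

lemma neg_le_invMills (c : ℝ) : -c ≤ invMills c :=
  (le_div_iff₀ (stdCdf_pos c)).2 (neg_mul_stdCdf_le c)

lemma antitone_invMills : Antitone invMills := by
  intro c c' hc
  have split : ∀ f : ℝ → ℝ, Integrable f →
      ∫ z in Set.Iio c', f z = (∫ z in Set.Iio c, f z) + ∫ z in Set.Ico c c', f z := by
    intro f hf
    rw [← Set.Iio_union_Ico_eq_Iio hc]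
    refine setIntegral_union ?_ measurableSet_Ico hf.integrableOn hf.integrableOn
    exact Set.disjoint_left.2 fun z hz hz' => absurd hz'.1 (not_le.2 hz)
  have hA := split _ integrable_stdPdf
  have hB := split _ integrable_mul_stdPdf
  have hA0 : 0 ≤ ∫ z in Set.Ico c c', stdPdf z :=
    setIntegral_nonneg measurableSet_Ico fun z _ => (stdPdf_pos z).le
  have hAB : c * ∫ z in Set.Ico c c', stdPdf z ≤ ∫ z in Set.Ico c c', z * stdPdf z := by
    rw [← integral_const_mul]
    refine setIntegral_mono_on (integrable_stdPdf.const_mul c).integrableOn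
      integrable_mul_stdPdf.integrableOn measurableSet_Ico fun z hz => ?_
    exact mul_le_mul_of_nonneg_right hz.1 (stdPdf_pos z).le
  rw [integral_Iio_mul_stdPdf, integral_Iio_mul_stdPdf] at hB
  have h1 := neg_mul_stdCdf_le c
  have h2 := stdCdf_pos c
  unfold invMills
  rw [div_le_div_iff₀ (stdCdf_pos _) (stdCdf_pos _)]
  change stdCdf c' = stdCdf c + _ at hA
  rw [hA]
  set A := ∫ z in Set.Ico c c', stdPdf z
  set B := ∫ z in Set.Ico c c', z * stdPdf z
  have h3 : stdPdf c' = stdPdf c - B := by linarith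
  rw [h3]
  nlinarith [mul_le_mul_of_nonneg_right hAB h2.le, mul_le_mul_of_nonneg_right h1 hA0]

lemma tendsto_invMills_atTop : Filter.Tendsto invMills Filter.atTop (nhds 0) := by
  have h : Filter.Tendsto (fun c => stdPdf c / stdCdf 0) Filter.atTop (nhds 0) := by
    simpa using tendsto_stdPdf_atTop.div_const (stdCdf 0)
  refine squeeze_zero' (Filter.Eventually.of_forall fun c => (invMills_pos c).le) ?_ h
  filter_upwards [Filter.eventually_ge_atTop 0] with c hc
  exact div_le_div_of_nonneg_left (stdPdf_pos c).le (stdCdf_pos 0) (stdCdf_mono hc)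

lemma cFun_zero : cFun 0 = 0 := by simp [cFun]

lemma cFun_of_pos {y : ℝ} (hy : 0 < y) : cFun y = sInf {c | invMills c ≤ y} := by
  simp [cFun, hy, invMills]

lemma cFun_neg_of_pos {y : ℝ} (hy : 0 < y) : cFun (-y) = -cFun y := by
  rw [cFun_of_pos hy, ← Real.sSup_neg]
  simp only [cFun, hy, not_lt.2 hy.le, Left.neg_pos_iff, Left.neg_neg_iff, if_true, if_false,
    one_sub_stdCdf, neg_neg]
  congr 1
  ext c
  simp [invMills, stdPdf_neg]

lemma bddBelow_invMills_le (y : ℝ) : BddBelow {c | invMills c ≤ y} :=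
  ⟨-y, fun c hc => by linarith [neg_le_invMills c, show invMills c ≤ y from hc]⟩

lemma nonempty_invMills_le {y : ℝ} (hy : 0 < y) : {c | invMills c ≤ y}.Nonempty :=
  (tendsto_invMills_atTop.eventually (ge_mem_nhds hy)).exists

lemma invMills_cFun {y : ℝ} (hy : 0 < y) : invMills (cFun y) = y := by
  rw [cFun_of_pos hy]
  have hmem := (isClosed_le continuous_invMills continuous_const).csInf_mem
    (nonempty_invMills_le hy) (bddBelow_invMills_le y)
  refine le_antisymm hmem ?_
  set c := sInf {c | invMills c ≤ y}
  have h : Filter.Tendsto invMills (nhdsWithin c (Set.Iio c)) (nhds (invMills c)) :=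
    continuous_invMills.continuousAt.tendsto.mono_left nhdsWithin_le_nhds
  refine ge_of_tendsto h ?_
  filter_upwards [self_mem_nhdsWithin] with d hd
  exact (not_le.1 fun h' => notMem_of_lt_csInf hd (bddBelow_invMills_le y) h').le

lemma cFun_anti {y y' : ℝ} (hy : 0 < y) (h : y ≤ y') : cFun y' ≤ cFun y := by
  rw [cFun_of_pos hy, cFun_of_pos (hy.trans_le h)]
  exact csInf_le_csInf (bddBelow_invMills_le y') (nonempty_invMills_le hy)
    fun c (hc : invMills c ≤ y) => hc.trans h

lemma neg_le_cFun {y : ℝ} (hy : 0 < y) : -y ≤ cFun y := by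
  have := neg_le_invMills (cFun y)
  rw [invMills_cFun hy] at this
  linarith

/-- One round of the EvE dynamics of the confidence interval. -/
def eveStep (T : ℕ) (θ : ℝ) (s a : ℝ × ℝ) : ℝ × ℝ :=
  updThr θ (eveRho T s.1 s.2 a.1) s.1 s.2 a.1 a.2

/-- Regret of one round of the EvE policy started at the confidence interval `s`. -/
def eveReg (T : ℕ) (θ : ℝ) (s a : ℝ × ℝ) : ℝ :=
  if bThr θ (eveRho T s.1 s.2 a.1) a.1 a.2 = bStar θ a.1 a.2 then 0 else |a.1 * θ + a.2|

lemma eveReg_nonneg (T : ℕ) (θ : ℝ) (s a : ℝ × ℝ) : 0 ≤ eveReg T θ s a := by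
  unfold eveReg; split_ifs <;> positivity

lemma eveReg_le (T : ℕ) {θ : ℝ} (hθ : |θ| ≤ 1) (s a : ℝ × ℝ) :
    eveReg T θ s a ≤ |a.1| + |a.2| := by
  unfold eveReg
  split_ifs
  · positivity
  · refine (abs_add_le _ _).trans (add_le_add_left ?_ _)
    rw [abs_mul]
    exact mul_le_of_le_one_right (abs_nonneg _) hθ

lemma updThr_cases (θ ρ l u : ℝ) {x : ℝ} (hx : x ≠ 0) (z : ℝ) :
    (updThr θ ρ l u x z = (l, min u (-(ZThr ρ z / x))) ∧ θ ≤ -(ZThr ρ z / x)) ∨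
      (updThr θ ρ l u x z = (max l (-(ZThr ρ z / x)), u) ∧ -(ZThr ρ z / x) ≤ θ) := by
  unfold updThr bThr sgn
  have key : x * θ + ZThr ρ z = x * (θ - -(ZThr ρ z / x)) := by field_simp; ring
  rcases lt_or_gt_of_ne hx with h | h <;> by_cases hb : 0 < x * θ + ZThr ρ z
  · left
    simp only [hb, not_lt.2 h.le, if_true, if_false]
    norm_num
    rw [key] at hb
    linarith [neg_of_mul_pos_right hb h.le]
  · right
    simp only [hb, not_lt.2 h.le, if_false]
    norm_num
    rw [key, not_lt] at hb
    linarith [nonneg_of_mul_nonpos_right hb h]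
  · right
    simp only [hb, h, if_true]
    norm_num
    rw [key] at hb
    linarith [(pos_iff_pos_of_mul_pos hb).1 h]
  · left
    simp only [hb, h, if_true, if_false]
    norm_num
    rw [key, not_lt] at hb
    linarith [nonpos_of_mul_nonpos_right hb h]

/-- Linear independence over `ℚ` of two reals. -/
def RatIndep (l u : ℝ) : Prop := ∀ q r : ℚ, (q : ℝ) * l + r * u = 0 → q = 0 ∧ r = 0

lemma RatIndep.symm {l u : ℝ} (h : RatIndep l u) : RatIndep u l := fun q r hqr =>
  (h r q (by rw [add_comm]; exact hqr)).symm

lemma RatIndep.left_ne_zero {l u : ℝ} (h : RatIndep l u) : l ≠ 0 := fun h0 => by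
  have := h 1 0 (by simp [h0]); simp at this

lemma RatIndep.mid_ne_zero {l u : ℝ} (h : RatIndep l u) : (l + u) / 2 ≠ 0 := fun h0 => by
  have := h 1 1 (by push_cast; linarith); simp at this

lemma RatIndep.mid {l u : ℝ} (h : RatIndep l u) : RatIndep l ((l + u) / 2) := fun q r hqr => by
  obtain ⟨h1, h2⟩ := h (q + r / 2) (r / 2) (by push_cast; linarith)
  have hr : r = 0 := by linarith
  exact ⟨by rw [hr] at h1; linarith, hr⟩

lemma ratIndep_of_notMem {l v : ℝ} (hl : l ≠ 0)
    (hv : v ∉ Set.range fun q : ℚ => (q : ℝ) * l) : RatIndep l v := fun q r hqr => by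
  by_cases hr : r = 0
  · subst hr
    have : (q : ℝ) * l = 0 := by simpa using hqr
    exact ⟨by simpa [hl] using this, rfl⟩
  · refine absurd ⟨-q / r, ?_⟩ hv
    have hr' : (r : ℝ) ≠ 0 := by exact_mod_cast hr
    push_cast
    field_simp
    linarith

/-- Whether a state is reachable: the interval contains `θ`, lies in `[-1, 1]`, and, while
exploring, is either the initial one or has endpoints linearly independent over `ℚ`. -/
def Reachable (T : ℕ) (θ : ℝ) (s : ℝ × ℝ) : Prop :=
  -1 ≤ s.1 ∧ s.1 ≤ θ ∧ θ ≤ s.2 ∧ s.2 ≤ 1 ∧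
    (1 / Real.sqrt T < s.2 - s.1 → s = (-1, 1) ∨ RatIndep s.1 s.2)

lemma ZThr_eq (ρ z : ℝ) : ZThr ρ z = if ρ < z then invMills (-ρ) else -invMills ρ := by
  simp [ZThr, truncMeanAbove_eq, truncMeanBelow_eq]

/-- In an exploration round the induced cut is either the midpoint `m` or an explicit
function of `x`. -/
lemma cut_cases {m x : ℝ} (hy : x * m ≠ 0) (z : ℝ) :
    -(ZThr (cFun (x * m)) z / x) = m ∨
      -(ZThr (cFun (x * m)) z / x) = -m * (invMills (-cFun |x * m|) / |x * m|) := by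
  have hx : x ≠ 0 := left_ne_zero_of_mul hy
  have hm : m ≠ 0 := right_ne_zero_of_mul hy
  rw [ZThr_eq]
  rcases lt_or_gt_of_ne hy with h | h
  · have h' : 0 < -(x * m) := by linarith
    rw [abs_of_neg h]
    have hc : cFun (x * m) = -cFun (-(x * m)) := by rw [← cFun_neg_of_pos h', neg_neg]
    rw [hc]
    split_ifs
    · left
      rw [neg_neg, invMills_cFun h']
      field_simp
    · right
      field_simp
  · rw [abs_of_pos h]
    split_ifs
    · right
      field_simp
    · left
      rw [invMills_cFun h]
      field_simp

lemma cut_eq_mid_of_pos {m x z : ℝ} (hx : 0 < x) (hx1 : x < 1) (hm : 0 < m) (hm1 : m ≤ 1)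
    (hz : z < -1) : -(ZThr (cFun (x * m)) z / x) = m := by
  have hy : 0 < x * m := mul_pos hx hm
  have h1 := neg_le_cFun hy
  have h2 : x * m ≤ 1 := mul_le_one₀ hx1.le hm.le hm1
  rw [ZThr_eq, if_neg (by linarith), invMills_cFun hy]
  field_simp

lemma cut_eq_mid_of_neg {m x z : ℝ} (hx : 0 < x) (hx1 : x < 1) (hm : m < 0) (hm1 : -1 ≤ m)
    (hz : 1 < z) : -(ZThr (cFun (x * m)) z / x) = m := by
  have hy : 0 < x * -m := mul_pos hx (by linarith)
  have h1 := neg_le_cFun hy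
  have h2 : x * -m ≤ 1 := mul_le_one₀ hx1.le (by linarith) (by linarith)
  have hc : cFun (x * m) = -cFun (x * -m) := by
    rw [← cFun_neg_of_pos hy, mul_neg, neg_neg]
  rw [ZThr_eq, hc, if_pos (by linarith), neg_neg, invMills_cFun hy]
  field_simp

lemma countable_cut_mem {m : ℝ} (hm : m ≠ 0) {S : Set ℝ} (hS : S.Countable) :
    {x : ℝ | x ≠ 0 ∧ -m * (invMills (-cFun |x * m|) / |x * m|) ∈ S}.Countable := by
  have hanti : StrictAntiOn (fun s : ℝ => invMills (-cFun s) / s) (Set.Ioi 0) := by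
    intro a ha b hb hab
    have h1 : invMills (-cFun b) ≤ invMills (-cFun a) :=
      antitone_invMills (neg_le_neg (cFun_anti ha hab.le))
    calc invMills (-cFun b) / b < invMills (-cFun b) / a :=
          div_lt_div_of_pos_left (invMills_pos _) ha hab
      _ ≤ invMills (-cFun a) / a := div_le_div_of_nonneg_right h1 (le_of_lt ha)
  have habs : ∀ x y : ℝ, x ≠ 0 → y ≠ 0 →
      -m * (invMills (-cFun |x * m|) / |x * m|) = -m * (invMills (-cFun |y * m|) / |y * m|) →
      |x| = |y| := by
    intro x y hx hy h
    have h1 := hanti.injOn (abs_pos.2 (mul_ne_zero hx hm)) (abs_pos.2 (mul_ne_zero hy hm))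
      (mul_left_cancel₀ (neg_ne_zero.2 hm) h)
    rw [abs_mul, abs_mul] at h1
    exact mul_right_cancel₀ (abs_ne_zero.2 hm) h1
  have hpos : {x : ℝ | 0 < x ∧ -m * (invMills (-cFun |x * m|) / |x * m|) ∈ S}.Countable :=
    Set.MapsTo.countable_of_injOn (fun x hx => hx.2) (fun x hx y hy h => by
      have := habs x y hx.1.ne' hy.1.ne' h
      rwa [abs_of_pos hx.1, abs_of_pos hy.1] at this) hS
  have hneg : {x : ℝ | x < 0 ∧ -m * (invMills (-cFun |x * m|) / |x * m|) ∈ S}.Countable :=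
    Set.MapsTo.countable_of_injOn (fun x hx => hx.2) (fun x hx y hy h => by
      have := habs x y hx.1.ne hy.1.ne h
      rw [abs_of_neg hx.1, abs_of_neg hy.1] at this
      linarith) hS
  refine (hneg.union hpos).mono fun x hx => ?_
  rcases lt_or_gt_of_ne hx.1 with h | h
  · exact Or.inl ⟨h, hx.2⟩
  · exact Or.inr ⟨h, hx.2⟩

lemma eveStep_bounds {T : ℕ} {θ : ℝ} {s a : ℝ × ℝ} (hx : a.1 ≠ 0) (h1 : s.1 ≤ θ)
    (h2 : θ ≤ s.2) :
    s.1 ≤ (eveStep T θ s a).1 ∧ (eveStep T θ s a).1 ≤ θ ∧ θ ≤ (eveStep T θ s a).2 ∧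
      (eveStep T θ s a).2 ≤ s.2 := by
  unfold eveStep
  rcases updThr_cases θ (eveRho T s.1 s.2 a.1) s.1 s.2 hx a.2 with ⟨h, hv⟩ | ⟨h, hv⟩ <;> rw [h]
  · exact ⟨le_rfl, h1, le_min h2 hv, min_le_left _ _⟩
  · exact ⟨le_max_left _ _, max_le h1 hv, h2, le_rfl⟩

/-- From a state with cut `v`, the next interval has endpoints among those of the old one
and `v`. -/
lemma eveStep_mem {T : ℕ} {θ v : ℝ} {s a : ℝ × ℝ} (hx : a.1 ≠ 0)
    (hv : -(ZThr (eveRho T s.1 s.2 a.1) a.2 / a.1) = v) :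
    eveStep T θ s a = s ∨ eveStep T θ s a = (s.1, v) ∨ eveStep T θ s a = (v, s.2) := by
  unfold eveStep
  rcases updThr_cases θ (eveRho T s.1 s.2 a.1) s.1 s.2 hx a.2 with ⟨h, -⟩ | ⟨h, -⟩ <;> rw [h, hv]
  · rcases min_choice s.2 v with h' | h' <;> simp [h']
  · rcases max_choice s.1 v with h' | h' <;> simp [h']

lemma Reachable.step {T : ℕ} {θ : ℝ} {s : ℝ × ℝ} (hs : Reachable T θ s) :
    ∃ B : Set ℝ, B.Countable ∧
      ∀ a : ℝ × ℝ, a.1 ∉ B → a.1 ≠ 0 ∧ Reachable T θ (eveStep T θ s a) := by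
  obtain ⟨hl, hlθ, hθu, hu, hind⟩ := hs
  suffices h : ∃ B : Set ℝ, B.Countable ∧ 0 ∈ B ∧ ∀ a : ℝ × ℝ, a.1 ∉ B →
      1 / Real.sqrt T < (eveStep T θ s a).2 - (eveStep T θ s a).1 →
      eveStep T θ s a = (-1, 1) ∨ RatIndep (eveStep T θ s a).1 (eveStep T θ s a).2 by
    obtain ⟨B, hB, h0, h⟩ := h
    refine ⟨B, hB, fun a ha => ?_⟩
    have hx : a.1 ≠ 0 := fun hx => ha (hx ▸ h0)
    obtain ⟨h1, h2, h3, h4⟩ := eveStep_bounds (T := T) hx hlθ hθu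
    exact ⟨hx, hl.trans h1, h2, h3, h4.trans hu, h a ha⟩
  by_cases hw : 1 / Real.sqrt T < s.2 - s.1
  swap
  · refine ⟨{0}, Set.countable_singleton 0, rfl, fun a ha hw' => absurd ?_ hw⟩
    obtain ⟨h1, -, -, h4⟩ := eveStep_bounds (T := T) (a := a) ha hlθ hθu
    linarith
  have hrho : ∀ x, eveRho T s.1 s.2 x = cFun (x * ((s.1 + s.2) / 2)) := fun x => by
    simp only [eveRho, hw, if_true]
  rcases hind hw with rfl | hI
  · refine ⟨insert 0 (Set.range fun q : ℚ => invMills 0 / q), (Set.countable_range _).insert 0,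
      Set.mem_insert _ _, fun a ha _ => ?_⟩
    rw [Set.mem_insert_iff, not_or] at ha
    obtain ⟨hx, ha⟩ := ha
    set v := -(ZThr (eveRho T (-1) 1 a.1) a.2 / a.1) with hv
    have hq : ∀ q : ℚ, v ≠ q := by
      intro q hvq
      have h0 := invMills_pos 0
      rw [hrho, ZThr_eq] at hv
      norm_num [cFun_zero] at hv
      have hq0 : q ≠ 0 := by
        rintro rfl
        rw [hvq] at hv
        split_ifs at hv <;> simp at hv <;> rcases hv with h | h <;> first | linarith | exact hx h
      have hq0' : (q : ℝ) ≠ 0 := by exact_mod_cast hq0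
      rw [hvq] at hv
      split_ifs at hv
      · refine ha ⟨-q, ?_⟩
        push_cast
        rw [hv]
        field_simp
      · refine ha ⟨q, ?_⟩
        simp only
        rw [hv]
        field_simp
    rcases eveStep_mem (T := T) (θ := θ) (s := (-1, 1)) hx hv.symm with h | h | h <;> rw [h]
    · exact Or.inl rfl
    · refine Or.inr (ratIndep_of_notMem (by norm_num) ?_)
      rintro ⟨q, hq'⟩
      exact hq (-q) (by push_cast; simp at hq'; linarith)
    · refine Or.inr (ratIndep_of_notMem (by norm_num) ?_).symm
      rintro ⟨q, hq'⟩
      exact hq q (by simp at hq'; linarith)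
  · have hm := hI.mid_ne_zero
    refine ⟨insert 0 {x : ℝ | x ≠ 0 ∧ -((s.1 + s.2) / 2) *
      (invMills (-cFun |x * ((s.1 + s.2) / 2)|) / |x * ((s.1 + s.2) / 2)|) ∈
        (Set.range fun q : ℚ => (q : ℝ) * s.1) ∪ Set.range fun q : ℚ => (q : ℝ) * s.2},
      (countable_cut_mem hm ((Set.countable_range _).union (Set.countable_range _))).insert 0,
      Set.mem_insert _ _, fun a ha _ => Or.inr ?_⟩
    rw [Set.mem_insert_iff, not_or] at ha
    obtain ⟨hx, ha⟩ := ha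
    have hcut := cut_cases (mul_ne_zero hx hm) a.2
    rw [← hrho] at hcut
    rcases hcut with hv | hv
    · rcases eveStep_mem (T := T) (θ := θ) hx hv with h | h | h <;> rw [h]
      · exact hI
      · exact hI.mid
      · have := hI.symm.mid.symm
        rwa [add_comm s.2 s.1] at this
    · have hmem : ¬ _ := fun h => ha ⟨hx, h⟩
      rw [← hv, Set.mem_union, not_or] at hmem
      rcases eveStep_mem (T := T) (θ := θ) hx rfl with h | h | h <;> rw [h]
      · exact hI
      · exact ratIndep_of_notMem hI.left_ne_zero hmem.1
      · exact (ratIndep_of_notMem hI.symm.left_ne_zero hmem.2).symm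

lemma stdNormal_real_pos {A : Set ℝ} (hA : IsOpen A) (hne : A.Nonempty) :
    0 < stdNormal.real A := by
  refine ENNReal.toReal_pos (fun h => ?_) (measure_ne_top _ _)
  exact (hA.measure_pos volume hne).ne'
    (gaussianReal_absolutelyContinuous' 0 one_ne_zero h)

lemma eveStep_width_le_of_cut {T : ℕ} {θ v : ℝ} {s a : ℝ × ℝ} (hx : a.1 ≠ 0)
    (hv : -(ZThr (eveRho T s.1 s.2 a.1) a.2 / a.1) = v) :
    (eveStep T θ s a).2 - (eveStep T θ s a).1 ≤ max (v - s.1) (s.2 - v) := by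
  unfold eveStep
  rcases updThr_cases θ (eveRho T s.1 s.2 a.1) s.1 s.2 hx a.2 with ⟨h, -⟩ | ⟨h, -⟩ <;> rw [h, hv]
  · exact le_max_of_le_left (sub_le_sub_right (min_le_right _ _) _)
  · exact le_max_of_le_right (sub_le_sub_left (le_max_right _ _) _)

/-- In every exploration round the interval shrinks by a constant factor with probability
bounded below. -/
lemma exists_shrink_prob : ∃ p : ℝ, 0 < p ∧ ∀ (T : ℕ) (θ : ℝ) (s : ℝ × ℝ), Reachable T θ s →
    1 / Real.sqrt T < s.2 - s.1 → ∃ E : Set (ℝ × ℝ), MeasurableSet E ∧ p ≤ stdNormal2.real E ∧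
      ∀ a ∈ E, (eveStep T θ s a).2 - (eveStep T θ s a).1 ≤ 3 / 4 * (s.2 - s.1) := by
  have hpos : ∀ A B : Set ℝ, IsOpen A → A.Nonempty → IsOpen B → B.Nonempty →
      0 < stdNormal2.real (A ×ˢ B) := fun A B hA hA' hB hB' => by
    rw [stdNormal2, measureReal_prod_prod]
    exact mul_pos (stdNormal_real_pos hA hA') (stdNormal_real_pos hB hB')
  have h1 := hpos (Set.Ioi (2 * invMills 0)) Set.univ isOpen_Ioi Set.nonempty_Ioi isOpen_univ
    Set.univ_nonempty
  have h2 := hpos (Set.Ioo 0 1) (Set.Iio (-1)) isOpen_Ioo (Set.nonempty_Ioo.2 one_pos) isOpen_Iio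
    Set.nonempty_Iio
  have h3 := hpos (Set.Ioo 0 1) (Set.Ioi 1) isOpen_Ioo (Set.nonempty_Ioo.2 one_pos) isOpen_Ioi
    Set.nonempty_Ioi
  refine ⟨_, lt_min h1 (lt_min h2 h3), fun T θ s hs hw => ?_⟩
  obtain ⟨hl, hlθ, hθu, hu, hind⟩ := hs
  have hrho : ∀ x, eveRho T s.1 s.2 x = cFun (x * ((s.1 + s.2) / 2)) := fun x => by
    simp only [eveRho, hw, if_true]
  rcases hind hw with rfl | hI
  · refine ⟨_, measurableSet_Ioi.prod MeasurableSet.univ, min_le_left _ _, fun a ha => ?_⟩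
    have hx : 2 * invMills 0 < a.1 := ha.1
    have h0 := invMills_pos 0
    have hx0 : 0 < a.1 := by linarith
    refine (eveStep_width_le_of_cut hx0.ne' rfl).trans ?_
    rw [hrho, ZThr_eq]
    norm_num [cFun_zero]
    have hk : invMills 0 / a.1 ≤ 1 / 2 := by rw [div_le_iff₀ hx0]; linarith
    have hk0 : 0 < invMills 0 / a.1 := by positivity
    split_ifs
    · constructor <;> linarith
    · rw [neg_div]
      constructor <;> linarith
  · rcases lt_or_gt_of_ne hI.mid_ne_zero with hm | hm
    · refine ⟨_, measurableSet_Ioo.prod measurableSet_Ioi,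
        (min_le_right _ _).trans (min_le_right _ _), fun a ha => ?_⟩
      have hv := cut_eq_mid_of_neg ha.1.1 ha.1.2 hm (by linarith) ha.2
      rw [← hrho] at hv
      refine (eveStep_width_le_of_cut ha.1.1.ne' hv).trans (max_le ?_ ?_) <;> linarith
    · refine ⟨_, measurableSet_Ioo.prod measurableSet_Iio,
        (min_le_right _ _).trans (min_le_left _ _), fun a ha => ?_⟩
      have hv := cut_eq_mid_of_pos ha.1.1 ha.1.2 hm (by linarith) ha.2
      rw [← hrho] at hv
      refine (eveStep_width_le_of_cut ha.1.1.ne' hv).trans (max_le ?_ ?_) <;> linarith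

lemma setIntegral_stdNormal {A : Set ℝ} (hA : MeasurableSet A) (f : ℝ → ℝ) :
    ∫ z in A, f z ∂stdNormal = ∫ z in A, stdPdf z * f z := by
  rw [← integral_indicator hA, ← integral_indicator hA, stdNormal,
    integral_gaussianReal_eq_integral_smul one_ne_zero, stdPdf_eq_gaussianPDFReal]
  congr 1
  funext z
  by_cases hz : z ∈ A <;> simp [hz]

lemma integrable_id_stdNormal : Integrable (fun z : ℝ => z) stdNormal :=
  (memLp_id_gaussianReal (μ := 0) (v := 1) 1).integrable le_rfl

lemma integrable_sq_stdNormal : Integrable (fun z : ℝ => z ^ 2) stdNormal :=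
  (memLp_id_gaussianReal (μ := 0) (v := 1) 2).integrable_sq

lemma setIntegral_Ioi_add_stdNormal (c ρ : ℝ) :
    ∫ z in Set.Ioi ρ, (c + z) ∂stdNormal = stdCdf (-ρ) * (c + truncMeanAbove ρ) := by
  rw [setIntegral_stdNormal measurableSet_Ioi]
  have h : ∀ z, stdPdf z * (c + z) = c * stdPdf z + z * stdPdf z := fun z => by ring
  simp only [h]
  rw [integral_add (integrable_stdPdf.const_mul c).integrableOn
    integrable_mul_stdPdf.integrableOn, integral_const_mul, truncMeanAbove_eq,
    integral_Ioi_mul_stdPdf, integral_Ioi_stdPdf, invMills, stdPdf_neg]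
  have := (stdCdf_pos (-ρ)).ne'
  field_simp

lemma setIntegral_Iic_add_stdNormal (c ρ : ℝ) :
    ∫ z in Set.Iic ρ, (c + z) ∂stdNormal = stdCdf ρ * (c + truncMeanBelow ρ) := by
  rw [setIntegral_stdNormal measurableSet_Iic, integral_Iic_eq_integral_Iio]
  have h : ∀ z, stdPdf z * (c + z) = c * stdPdf z + z * stdPdf z := fun z => by ring
  simp only [h]
  rw [integral_add (integrable_stdPdf.const_mul c).integrableOn
    integrable_mul_stdPdf.integrableOn, integral_const_mul, truncMeanBelow_eq,
    integral_Iio_mul_stdPdf, invMills, ← stdCdf]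
  have := (stdCdf_pos ρ).ne'
  field_simp

lemma stdNormal_real_Icc_le {a b : ℝ} (hab : a ≤ b) : stdNormal.real (Set.Icc a b) ≤ b - a := by
  have h := setIntegral_stdNormal (measurableSet_Icc (a := a) (b := b)) fun _ => 1
  simp only [integral_const, MeasurableSet.univ, measureReal_restrict_apply, Set.univ_inter,
    smul_eq_mul, mul_one] at h
  rw [h]
  calc ∫ z in Set.Icc a b, stdPdf z ≤ ∫ z in Set.Icc a b, (1 : ℝ) :=
        setIntegral_mono_on integrable_stdPdf.integrableOn
          (integrableOn_const (by simp)) measurableSet_Icc fun z _ => stdPdf_le_one z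
    _ = b - a := by simp [hab]

/-- Expected regret, for a fixed context `x`, of the straightforward policy based on an
estimate `m` of `θ` with error at most `w`. -/
lemma lintegral_regret_straightforward_le {θ m w : ℝ} (hw : |θ - m| ≤ w) (x : ℝ) :
    ∫⁻ z, ENNReal.ofReal (if bThr θ (-(x * m)) x z = bStar θ x z then 0 else |x * θ + z|)
      ∂stdNormal ≤ ENNReal.ofReal (2 * w ^ 2 * x ^ 2) := by
  set ρ := -(x * m) with hρ
  have hw0 : 0 ≤ w := (abs_nonneg _).trans hw
  set r := |x| * w with hr
  have hr0 : 0 ≤ r := by positivity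
  have hxr : |x * θ - x * m| ≤ r := by
    rw [← mul_sub, abs_mul]; exact mul_le_mul_of_nonneg_left hw (abs_nonneg x)
  obtain ⟨hxr1, hxr2⟩ := abs_le.1 hxr
  set α : ℝ := if 0 < x * θ + truncMeanAbove ρ then 0 else 1 with hα
  set β : ℝ := if 0 < x * θ + truncMeanBelow ρ then 1 else 0 with hβ
  set D : ℝ → ℝ := (Set.Icc (-(x * θ) - r) (-(x * θ) + r)).indicator fun _ => r with hD
  set S₁ : ℝ → ℝ := (Set.Ioi ρ).indicator fun z => α * (x * θ + z) with hS₁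
  set S₂ : ℝ → ℝ := (Set.Iic ρ).indicator fun z => -β * (x * θ + z) with hS₂
  have hlin : Integrable (fun z : ℝ => x * θ + z) stdNormal :=
    (integrable_const _).add integrable_id_stdNormal
  have iD : Integrable D stdNormal := (integrable_const r).indicator measurableSet_Icc
  have iS₁ : Integrable S₁ stdNormal := (hlin.const_mul α).indicator measurableSet_Ioi
  have iS₂ : Integrable S₂ stdNormal := (hlin.const_mul (-β)).indicator measurableSet_Iic
  have hD0 : ∀ z, 0 ≤ D z := fun z => Set.indicator_nonneg (fun _ _ => hr0) z
  have hDr : ∀ z, |x * θ + z| ≤ r → D z = r := fun z hz => by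
    obtain ⟨h1, h2⟩ := abs_le.1 hz
    have hmem : z ∈ Set.Icc (-(x * θ) - r) (-(x * θ) + r) := ⟨by linarith, by linarith⟩
    exact Set.indicator_of_mem hmem _
  have hpt : ∀ z, (if bThr θ ρ x z = bStar θ x z then 0 else |x * θ + z|) ≤
      D z + (S₁ z + S₂ z) := by
    intro z
    have hDz := hD0 z
    have hDz' := hDr z
    by_cases hz : ρ < z
    · have e1 : S₁ z = α * (x * θ + z) := Set.indicator_of_mem (show z ∈ Set.Ioi ρ from hz) _
      have e2 : S₂ z = 0 := Set.indicator_of_notMem (by simpa using hz) _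
      rw [e1, e2, hα]
      simp only [bThr, bStar, ZThr, hz, if_true]
      by_cases hb : 0 < x * θ + truncMeanAbove ρ <;> by_cases hs : 0 < x * θ + z <;>
        simp only [hb, hs, if_true, if_false]
      · norm_num; exact hDz
      · rw [not_lt] at hs
        norm_num [abs_of_nonpos hs] at hDz' ⊢
        rw [hDz' (by linarith)]
        linarith
      · norm_num [abs_of_pos hs]; exact hDz
      · rw [not_lt] at hs
        norm_num [abs_of_nonpos hs] at hDz' ⊢
        rw [hDz' (by linarith)]
        linarith
    · have e1 : S₁ z = 0 := Set.indicator_of_notMem (by simpa using hz) _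
      have e2 : S₂ z = -β * (x * θ + z) :=
        Set.indicator_of_mem (show z ∈ Set.Iic ρ from not_lt.1 hz) _
      rw [e1, e2, hβ]
      simp only [bThr, bStar, ZThr, hz, if_false]
      rw [not_lt] at hz
      by_cases hb : 0 < x * θ + truncMeanBelow ρ <;> by_cases hs : 0 < x * θ + z <;>
        simp only [hb, hs, if_true, if_false]
      · norm_num [abs_of_pos hs] at hDz' ⊢
        rw [hDz' (by linarith)]
        linarith
      · rw [not_lt] at hs
        norm_num [abs_of_nonpos hs]
        linarith
      · norm_num [abs_of_pos hs] at hDz' ⊢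
        rw [hDz' (by linarith)]
        linarith
      · norm_num; exact hDz
  have hI₁ : ∫ z, S₁ z ∂stdNormal ≤ 0 := by
    rw [hS₁, integral_indicator measurableSet_Ioi, integral_const_mul,
      setIntegral_Ioi_add_stdNormal, hα]
    split_ifs with h
    · simp
    · rw [one_mul]
      exact mul_nonpos_of_nonneg_of_nonpos (stdCdf_pos _).le (not_lt.1 h)
  have hI₂ : ∫ z, S₂ z ∂stdNormal ≤ 0 := by
    rw [hS₂, integral_indicator measurableSet_Iic, integral_const_mul,
      setIntegral_Iic_add_stdNormal, hβ]
    split_ifs with h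
    · have := mul_pos (stdCdf_pos ρ) h
      linarith
    · simp
  have hID : ∫ z, D z ∂stdNormal ≤ 2 * w ^ 2 * x ^ 2 := by
    rw [hD, integral_indicator_const r measurableSet_Icc, smul_eq_mul]
    have h1 := stdNormal_real_Icc_le (a := -(x * θ) - r) (b := -(x * θ) + r) (by linarith)
    calc _ ≤ (2 * r) * r := mul_le_mul_of_nonneg_right (by linarith) hr0
      _ = 2 * w ^ 2 * x ^ 2 := by rw [hr, ← sq_abs x]; ring
  calc _ ≤ ∫⁻ z, ENNReal.ofReal (D z + (S₁ z + S₂ z)) ∂stdNormal :=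
        lintegral_mono fun z => ENNReal.ofReal_le_ofReal (hpt z)
    _ = ENNReal.ofReal (∫ z, D z + (S₁ z + S₂ z) ∂stdNormal) := by
        refine (ofReal_integral_eq_lintegral_ofReal (iD.add (iS₁.add iS₂))
          (Filter.Eventually.of_forall fun z => le_trans ?_ (hpt z))).symm
        split_ifs <;> simp
    _ ≤ _ := by
        refine ENNReal.ofReal_le_ofReal ?_
        have h1 := integral_add iD (iS₁.add iS₂)
        have h2 := integral_add iS₁ iS₂
        simp only [Pi.add_apply] at h1
        linarith

open Classical in
/-- Potential of a state: a logarithm of the width, infinite at unreachable states. -/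
def evePotential (C : ℝ) (T : ℕ) (θ : ℝ) (s : ℝ × ℝ) : ENNReal :=
  if Reachable T θ s then ENNReal.ofReal (C * Real.log (1 + Real.sqrt T * (s.2 - s.1))) else ⊤

lemma Reachable.abs_le_one {T : ℕ} {θ : ℝ} {s : ℝ × ℝ} (hs : Reachable T θ s) : |θ| ≤ 1 :=
  abs_le.2 ⟨hs.1.trans hs.2.1, hs.2.2.1.trans hs.2.2.2.1⟩

lemma ae_notMem_of_countable {B : Set ℝ} (hB : B.Countable) :
    ∀ᵐ a ∂stdNormal2, a.1 ∉ B := by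
  have : NullSingletonClass stdNormal := nullSingletonClass_gaussianReal one_ne_zero
  exact Measure.quasiMeasurePreserving_fst.ae (hB.ae_notMem stdNormal)

lemma evePotential_step_le {C : ℝ} (hC : 0 ≤ C) {T : ℕ} {θ : ℝ} {s a : ℝ × ℝ}
    (hs : Reachable T θ s) (ha : a.1 ≠ 0) (hr : Reachable T θ (eveStep T θ s a)) :
    evePotential C T θ (eveStep T θ s a) ≤ evePotential C T θ s := by
  rw [evePotential, evePotential, if_pos hs, if_pos hr]
  obtain ⟨h1, h2, h3, h4⟩ := eveStep_bounds (T := T) ha hs.2.1 hs.2.2.1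
  have : 0 ≤ Real.sqrt T := Real.sqrt_nonneg _
  refine ENNReal.ofReal_le_ofReal (mul_le_mul_of_nonneg_left (Real.log_le_log ?_ ?_) hC)
  · have := mul_nonneg this (sub_nonneg.2 (h2.trans h3))
    linarith
  · have := mul_le_mul_of_nonneg_left (sub_le_sub h4 h1) this
    linarith

lemma lintegral_exploit_le {C : ℝ} (hC : 0 ≤ C) {T : ℕ} (hT : 0 < T) {θ : ℝ} {s : ℝ × ℝ}
    (hs : Reachable T θ s) (hw : ¬ 1 / Real.sqrt T < s.2 - s.1) :
    ∫⁻ a, (ENNReal.ofReal (eveReg T θ s a) + evePotential C T θ (eveStep T θ s a)) ∂stdNormal2 ≤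
      evePotential C T θ s + ENNReal.ofReal (2 * (∫ x, x ^ 2 ∂stdNormal) / T) := by
  obtain ⟨B, hB, hBs⟩ := hs.step
  have hT' : (0 : ℝ) < T := by exact_mod_cast hT
  have hrho : ∀ x, eveRho T s.1 s.2 x = -(x * ((s.1 + s.2) / 2)) := fun x => by
    simp only [eveRho, hw, if_false]
  have hθ : |θ - (s.1 + s.2) / 2| ≤ s.2 - s.1 := by
    have := hs.2.1
    have := hs.2.2.1
    rw [abs_le]; constructor <;> linarith
  have hw0 : 0 ≤ s.2 - s.1 := (abs_nonneg _).trans hθ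
  have hw2 : (s.2 - s.1) ^ 2 ≤ 1 / T := by
    calc (s.2 - s.1) ^ 2 ≤ (1 / Real.sqrt T) ^ 2 := pow_le_pow_left₀ hw0 (not_lt.1 hw) 2
      _ = 1 / T := by rw [div_pow, Real.sq_sqrt hT'.le, one_pow]
  calc _ ≤ ∫⁻ a, (ENNReal.ofReal (eveReg T θ s a) + evePotential C T θ s) ∂stdNormal2 := by
        refine lintegral_mono_ae ?_
        filter_upwards [ae_notMem_of_countable hB] with a ha
        exact add_le_add_right (evePotential_step_le hC hs (hBs a ha).1 (hBs a ha).2) _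
    _ = evePotential C T θ s + ∫⁻ a, ENNReal.ofReal (eveReg T θ s a) ∂stdNormal2 := by
        rw [lintegral_add_right _ measurable_const, lintegral_const, measure_univ, mul_one,
          add_comm]
    _ ≤ _ := by
        refine add_le_add_right ?_ _
        calc _ ≤ ∫⁻ x, ∫⁻ z, ENNReal.ofReal (eveReg T θ s (x, z)) ∂stdNormal ∂stdNormal :=
              lintegral_prod_le _
          _ ≤ ∫⁻ x, ENNReal.ofReal (2 * (s.2 - s.1) ^ 2 * x ^ 2) ∂stdNormal := by
              refine lintegral_mono fun x => ?_
              simp only [eveReg, hrho]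
              exact lintegral_regret_straightforward_le hθ x
          _ = ENNReal.ofReal (2 * (s.2 - s.1) ^ 2 * ∫ x, x ^ 2 ∂stdNormal) := by
              rw [← integral_const_mul, ofReal_integral_eq_lintegral_ofReal
                (integrable_sq_stdNormal.const_mul _)
                (Filter.Eventually.of_forall fun x => by positivity)]
          _ ≤ _ := by
              refine ENNReal.ofReal_le_ofReal ?_
              have h0 : 0 ≤ ∫ x, x ^ 2 ∂stdNormal := integral_nonneg fun x => sq_nonneg x
              calc _ = (s.2 - s.1) ^ 2 * (2 * ∫ x, x ^ 2 ∂stdNormal) := by ring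
                _ ≤ 1 / T * (2 * ∫ x, x ^ 2 ∂stdNormal) := by gcongr
                _ = _ := by ring

lemma integrable_abs_add_abs : Integrable (fun a : ℝ × ℝ => |a.1| + |a.2|) stdNormal2 :=
  (integrable_id_stdNormal.abs.comp_fst stdNormal).add
    (integrable_id_stdNormal.abs.comp_snd stdNormal)

lemma lintegral_explore_le {C p : ℝ} (hC : 0 ≤ C)
    (hCp : ∫ a, (|a.1| + |a.2|) ∂stdNormal2 ≤ C * Real.log (8 / 7) * p)
    {T : ℕ} (hT : 0 < T) {θ : ℝ} {s : ℝ × ℝ}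
    (hs : Reachable T θ s) (hw : 1 / Real.sqrt T < s.2 - s.1) {E : Set (ℝ × ℝ)}
    (hE : MeasurableSet E) (hpE : p ≤ stdNormal2.real E)
    (hshrink : ∀ a ∈ E, (eveStep T θ s a).2 - (eveStep T θ s a).1 ≤ 3 / 4 * (s.2 - s.1)) :
    ∫⁻ a, (ENNReal.ofReal (eveReg T θ s a) + evePotential C T θ (eveStep T θ s a)) ∂stdNormal2 ≤
      evePotential C T θ s := by
  obtain ⟨B, hB, hBs⟩ := hs.step
  have hT' : 0 < Real.sqrt T := Real.sqrt_pos.2 (by exact_mod_cast hT)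
  set A := Real.sqrt T * (s.2 - s.1) with hA
  have hA1 : 1 < A := by rwa [div_lt_iff₀' hT'] at hw
  have hlog : Real.log (8 / 7) ≤ Real.log (1 + A) :=
    Real.log_le_log (by norm_num) (by linarith)
  have hlog0 : 0 < Real.log (8 / 7) := Real.log_pos (by norm_num)
  set g : ℝ × ℝ → ℝ := fun a =>
    (|a.1| + |a.2|) + (C * Real.log (1 + A) - E.indicator (fun _ => C * Real.log (8 / 7)) a)
    with hg
  have hind : ∀ a, E.indicator (fun _ => C * Real.log (8 / 7)) a ≤ C * Real.log (1 + A) := by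
    intro a
    refine (Set.indicator_le_self' (fun _ _ => by positivity) a).trans ?_
    exact mul_le_mul_of_nonneg_left hlog hC
  have hiE : Integrable (E.indicator fun _ => C * Real.log (8 / 7)) stdNormal2 :=
    (integrable_const _).indicator hE
  have hgi : Integrable g stdNormal2 :=
    integrable_abs_add_abs.add ((integrable_const _).sub hiE)
  calc _ ≤ ∫⁻ a, ENNReal.ofReal (g a) ∂stdNormal2 := by
        refine lintegral_mono_ae ?_
        filter_upwards [ae_notMem_of_countable hB] with a ha
        obtain ⟨hx, hr⟩ := hBs a ha
        obtain ⟨h1, h2, h3, h4⟩ := eveStep_bounds (T := T) hx hs.2.1 hs.2.2.1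
        have hw' := mul_nonneg hT'.le (sub_nonneg.2 (h2.trans h3))
        rw [evePotential, if_pos hr, ← ENNReal.ofReal_add (eveReg_nonneg _ _ _ _)
          (mul_nonneg hC (Real.log_nonneg (by linarith)))]
        refine ENNReal.ofReal_le_ofReal (add_le_add (eveReg_le T hs.abs_le_one s a) ?_)
        by_cases haE : a ∈ E
        · rw [Set.indicator_of_mem haE, ← mul_sub]
          refine mul_le_mul_of_nonneg_left ?_ hC
          rw [← Real.log_div (by linarith) (by norm_num)]
          refine Real.log_le_log (by linarith) ?_
          have := mul_le_mul_of_nonneg_left (hshrink a haE) hT'.le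
          rw [le_div_iff₀ (by norm_num)]
          nlinarith
        · rw [Set.indicator_of_notMem haE, sub_zero]
          refine mul_le_mul_of_nonneg_left (Real.log_le_log (by linarith) ?_) hC
          have := mul_le_mul_of_nonneg_left (sub_le_sub h4 h1) hT'.le
          linarith
    _ = ENNReal.ofReal (∫ a, g a ∂stdNormal2) := by
        refine (ofReal_integral_eq_lintegral_ofReal hgi
          (Filter.Eventually.of_forall fun a => ?_)).symm
        have := hind a
        have : 0 ≤ |a.1| + |a.2| := by positivity
        simp only [Pi.zero_apply, hg]
        linarith
    _ ≤ evePotential C T θ s := by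
        rw [evePotential, if_pos hs]
        refine ENNReal.ofReal_le_ofReal ?_
        have h1 : ∫ a, g a ∂stdNormal2 = _ :=
          integral_add integrable_abs_add_abs ((integrable_const (C * Real.log (1 + A))).sub hiE)
        have h2 := integral_sub (integrable_const (C * Real.log (1 + A))) hiE
        rw [integral_indicator_const _ hE, integral_const, probReal_univ, one_smul,
          smul_eq_mul] at h2
        rw [h1, h2]
        have := mul_le_mul_of_nonneg_left hpE (mul_nonneg hC hlog0.le)
        linarith

/-- The orbit of the dynamical system `step` started at `s` and driven by `ω`. -/
def orbit {S A : Type*} (step : S → A → S) (s : S) (ω : ℕ → A) : ℕ → S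
  | 0 => s
  | t + 1 => step (orbit step s ω t) (ω t)

lemma orbit_succ' {S A : Type*} (step : S → A → S) (s : S) (ω : ℕ → A) (t : ℕ) :
    orbit step s ω (t + 1) = orbit step (step s (ω 0)) (fun i => ω (i + 1)) t := by
  induction t with
  | zero => rfl
  | succ t ih => rw [orbit, ih]; rfl

/-- If a potential pays for the expected cost of each step up to `c`, then the expected total
cost of `n` i.i.d. steps is at most the initial potential plus `n * c`. No measurability is
needed. -/
lemma lintegral_sum_orbit_le {S A : Type*} [MeasurableSpace A] (μ : Measure A)
    [IsProbabilityMeasure μ] (d : A) (step : S → A → S) (cost : S → A → ENNReal)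
    (V : S → ENNReal) (c : ENNReal)
    (h : ∀ s, ∫⁻ a, (cost s a + V (step s a)) ∂μ ≤ V s + c) (n : ℕ) (s : S) :
    ∫⁻ p : Fin n → A, (∑ t ∈ Finset.range n,
      cost (orbit step s (fun i => if hi : i < n then p ⟨i, hi⟩ else d) t)
        (if ht : t < n then p ⟨t, ht⟩ else d)) ∂(Measure.pi fun _ => μ) ≤ V s + n * c := by
  induction n generalizing s with
  | zero => simp
  | succ n ih =>
    set F : A × (Fin n → A) → ENNReal := fun q => cost s q.1 + ∑ t ∈ Finset.range n,
      cost (orbit step (step s q.1) (fun i => if hi : i < n then q.2 ⟨i, hi⟩ else d) t)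
        (if ht : t < n then q.2 ⟨t, ht⟩ else d) with hF
    have hmp := measurePreserving_piFinSuccAbove (fun _ : Fin (n + 1) => μ) 0
    calc _ = ∫⁻ p : Fin (n + 1) → A,
          F (MeasurableEquiv.piFinSuccAbove (fun _ => A) 0 p) ∂(Measure.pi fun _ => μ) := by
          refine lintegral_congr fun p => ?_
          rw [Finset.sum_range_succ', add_comm]
          congr 1
          refine Finset.sum_congr rfl fun t ht => ?_
          have ht' := Finset.mem_range.1 ht
          rw [orbit_succ']
          simp only [Nat.add_lt_add_iff_right, Nat.zero_lt_succ, dif_pos]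
          rfl
      _ = ∫⁻ q, F q ∂(μ.prod (Measure.pi fun _ => μ)) := hmp.lintegral_comp_emb
          (MeasurableEquiv.measurableEmbedding _) F
      _ ≤ ∫⁻ a, ∫⁻ q, F (a, q) ∂(Measure.pi fun _ => μ) ∂μ := lintegral_prod_le F
      _ ≤ ∫⁻ a, (cost s a + V (step s a) + n * c) ∂μ := by
          refine lintegral_mono fun a => ?_
          simp only [hF]
          rw [lintegral_add_left measurable_const, lintegral_const, measure_univ, mul_one,
            add_assoc]
          exact add_le_add_right (ih (step s a)) _
      _ = ∫⁻ a, (cost s a + V (step s a)) ∂μ + n * c := by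
          rw [lintegral_add_right _ measurable_const, lintegral_const, measure_univ, mul_one]
      _ ≤ V s + c + n * c := add_le_add_left (h s) _
      _ = V s + (n + 1 : ℕ) * c := by push_cast; ring

lemma eveLU_eq_orbit (T : ℕ) (θ : ℝ) (ω : ℕ → ℝ × ℝ) (t : ℕ) :
    eveLU T θ ω t = orbit (eveStep T θ) (-1, 1) ω t := by
  induction t with
  | zero => rfl
  | succ t ih => rw [orbit, ← ih]; rfl

lemma eveCumReg_eq_sum (T : ℕ) (θ : ℝ) (ω : ℕ → ℝ × ℝ) :
    eveCumReg T θ ω =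
      ∑ t ∈ Finset.range T, eveReg T θ (orbit (eveStep T θ) (-1, 1) ω t) (ω t) := by
  simp only [eveCumReg, eveLU_eq_orbit, eveReg]

/-- The potential decreases in expectation by the expected regret of the round, up to
`O(1 / T)`. -/
lemma exists_evePotential_drift : ∃ C K : ℝ, 0 < C ∧ 0 ≤ K ∧ ∀ (T : ℕ), 0 < T →
    ∀ (θ : ℝ) (s : ℝ × ℝ),
    ∫⁻ a, (ENNReal.ofReal (eveReg T θ s a) + evePotential C T θ (eveStep T θ s a)) ∂stdNormal2 ≤
      evePotential C T θ s + ENNReal.ofReal (K / T) := by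
  obtain ⟨p, hp, hshrink⟩ := exists_shrink_prob
  have hlog0 : 0 < Real.log (8 / 7) := Real.log_pos (by norm_num)
  have hM : 0 ≤ ∫ a, (|a.1| + |a.2|) ∂stdNormal2 :=
    integral_nonneg fun a => by simp only [Pi.zero_apply]; positivity
  set M := ∫ a, (|a.1| + |a.2|) ∂stdNormal2
  have hC : 0 < (M + 1) / (Real.log (8 / 7) * p) := by positivity
  refine ⟨(M + 1) / (Real.log (8 / 7) * p), 2 * ∫ x, x ^ 2 ∂stdNormal, hC,
    mul_nonneg two_pos.le (integral_nonneg fun x => sq_nonneg x), fun T hT θ s => ?_⟩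
  by_cases hs : Reachable T θ s
  · by_cases hw : 1 / Real.sqrt T < s.2 - s.1
    · obtain ⟨E, hE, hpE, hsh⟩ := hshrink T θ s hs hw
      refine le_add_right (lintegral_explore_le hC.le ?_ hT hs hw hE hpE hsh)
      change M ≤ _
      rw [mul_assoc, div_mul_cancel₀ _ (by positivity)]
      linarith
    · exact lintegral_exploit_le hC.le hT hs hw
  · rw [evePotential, if_neg hs, top_add]
    exact le_top

lemma uniformState_univ : uniformState Set.univ = 1 := by
  simp only [uniformState, Measure.smul_apply, Measure.restrict_apply MeasurableSet.univ,
    Set.univ_inter, Real.volume_Icc, smul_eq_mul]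
  norm_num
  exact ENNReal.inv_mul_cancel (by norm_num) (by norm_num)

/-- **Regret bound of the EvE (exploration-versus-exploitation) policy.** There is
a universal constant `C_EvE > 0` such that for all `T ≥ 2` the expected cumulative
regret (over `θ ~ Unif[-1,1]` and i.i.d. standard normal contexts and dynamic
payoffs) is at most `C_EvE · log T`. -/
theorem eve_cumulative_regret_upper_bound :
    ∃ CEvE : ℝ, 0 < CEvE ∧
      ∀ T : ℕ, 2 ≤ T →
        ∫ p : ℝ × (Fin T → ℝ × ℝ),
          eveCumReg T p.1 (fun t => if h : t < T then p.2 ⟨t, h⟩ else 0)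
          ∂(uniformState.prod (Measure.pi fun _ : Fin T => stdNormal2)) ≤
        CEvE * Real.log T := by
  obtain ⟨C, K, hC, hK, hdrift⟩ := exists_evePotential_drift
  refine ⟨3 * C + 2 * K, by positivity, fun T hT => ?_⟩
  have hT0 : 0 < T := by omega
  have hT2 : (2 : ℝ) ≤ T := by exact_mod_cast hT
  have hlog2 : 1 / 2 ≤ Real.log T :=
    (by linarith [Real.log_two_gt_d9] : 1 / 2 ≤ Real.log 2).trans
      (Real.log_le_log two_pos hT2)
  set R : ℝ × (Fin T → ℝ × ℝ) → ℝ := fun p =>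
    eveCumReg T p.1 (fun t => if h : t < T then p.2 ⟨t, h⟩ else 0) with hR
  have hR0 : ∀ p, 0 ≤ R p := fun p => by
    simp only [hR, eveCumReg_eq_sum]
    exact Finset.sum_nonneg fun t _ => eveReg_nonneg _ _ _ _
  have hbound : C * Real.log (1 + Real.sqrt T * 2) + K ≤ (3 * C + 2 * K) * Real.log T := by
    have h1 : Real.sqrt T ≤ T := Real.sqrt_le_iff.2 ⟨by linarith, by nlinarith⟩
    have h2 : Real.log (1 + Real.sqrt T * 2) ≤ 3 * Real.log T := by
      have h3 : Real.log ((T : ℝ) ^ 3) = 3 * Real.log T := by rw [Real.log_pow]; norm_num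
      rw [← h3]
      refine Real.log_le_log (by positivity) ?_
      nlinarith [mul_nonneg (sub_nonneg.2 hT2) (sub_nonneg.2 hT2), sq_nonneg (T : ℝ)]
    nlinarith [mul_le_mul_of_nonneg_left h2 hC.le, mul_le_mul_of_nonneg_left hlog2 hK]
  have hrhs : 0 ≤ (3 * C + 2 * K) * Real.log T := by
    have : 0 ≤ Real.log T := by linarith
    positivity
  have hlin : ∫⁻ p, ENNReal.ofReal (R p)
      ∂(uniformState.prod (Measure.pi fun _ : Fin T => stdNormal2)) ≤
        ENNReal.ofReal ((3 * C + 2 * K) * Real.log T) := by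
    calc _ ≤ ∫⁻ θ, ∫⁻ q, ENNReal.ofReal (R (θ, q)) ∂(Measure.pi fun _ : Fin T => stdNormal2)
          ∂uniformState := lintegral_prod_le _
      _ ≤ ∫⁻ _, ENNReal.ofReal ((3 * C + 2 * K) * Real.log T) ∂uniformState := by
          refine lintegral_mono_ae ?_
          have hmem : ∀ᵐ θ ∂uniformState, θ ∈ Set.Icc (-1 : ℝ) 1 :=
            Measure.ae_smul_measure (ae_restrict_mem measurableSet_Icc) _
          filter_upwards [hmem] with θ hθ
          have hstart : Reachable T θ (-1, 1) := ⟨le_rfl, hθ.1, hθ.2, le_rfl, fun _ => Or.inl rfl⟩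
          have h := lintegral_sum_orbit_le stdNormal2 0 (eveStep T θ)
            (fun s a => ENNReal.ofReal (eveReg T θ s a)) (evePotential C T θ)
            (ENNReal.ofReal (K / T)) (hdrift T hT0 θ) T (-1, 1)
          simp only [hR, eveCumReg_eq_sum]
          simp_rw [ENNReal.ofReal_sum_of_nonneg fun t _ => eveReg_nonneg _ _ _ _]
          refine h.trans ?_
          rw [evePotential, if_pos hstart, ← ENNReal.ofReal_natCast,
            ← ENNReal.ofReal_mul (by positivity), mul_div_cancel₀ _ (by positivity),
            ← ENNReal.ofReal_add (mul_nonneg hC.le (Real.log_nonneg ?_)) hK]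
          · refine ENNReal.ofReal_le_ofReal (le_trans (le_of_eq ?_) hbound)
            norm_num
          · norm_num
      _ = _ := by rw [lintegral_const, uniformState_univ, mul_one]
  by_cases hi : Integrable R (uniformState.prod (Measure.pi fun _ : Fin T => stdNormal2))
  · rw [integral_eq_lintegral_of_nonneg_ae (Filter.Eventually.of_forall hR0)
      hi.aestronglyMeasurable]
    exact ENNReal.toReal_le_of_le_ofReal hrhs hlin
  · rw [integral_undef hi]
    exact hrhs

end
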